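/- Let S be a compact convex subset of ℝ³ with affine hull ℝ³. Then S is affinely isomorphic to a tetrahedron or to the closed 3-dimensional unit ball if and only if the group of bijective affine transformations of S acts transitively on the extreme points of S and S is distinguishably decomposable. -/

import Mathlib

noncomputable section

/-- `S` is affinely isomorphic to `T`: there is a bijective affine map from `S` onto `T`. -/
def AffIso {E F : Type*} [NormedAddCommGroup E] [NormedSpace ℝ E]
    [NormedAddCommGroup F] [NormedSpace ℝ F] (S : Set E) (T : Set F) : Prop :=
  ∃ f : E →ᵃ[ℝ] F, Set.InjOn f S ∧ f '' S = T

/-- The group of bijective affine transformations of `S` acts transitively on the set of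
extreme points of `S`. -/
def AutTransitiveOnExtreme {E : Type*} [NormedAddCommGroup E] [NormedSpace ℝ E]
    (S : Set E) : Prop :=
  ∀ x ∈ Set.extremePoints ℝ S, ∀ y ∈ Set.extremePoints ℝ S,
    ∃ f : E ≃ᵃ[ℝ] E, f '' S = S ∧ f x = y

/-- The points `s 0, …, s (k-1)` of the convex set `S` are distinguishable: there are affine
functionals `e i` that are nonnegative on `S`, sum to `1` on `S`, and satisfy `e i (s i) = 1`. -/
def Distinguishable {E : Type*} [NormedAddCommGroup E] [NormedSpace ℝ E]
    (S : Set E) {k : ℕ} (s : Fin k → E) : Prop :=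
  ∃ e : Fin k → (E →ᵃ[ℝ] ℝ),
    (∀ i, ∀ x ∈ S, 0 ≤ e i x) ∧ (∀ x ∈ S, ∑ i, e i x = 1) ∧ (∀ i, e i (s i) = 1)

/-- `S` is distinguishably decomposable: every point of `S` is a finite convex combination of
distinguishable extreme points of `S`. -/
def DistinguishablyDecomposable {E : Type*} [NormedAddCommGroup E] [NormedSpace ℝ E]
    (S : Set E) : Prop :=
  ∀ x ∈ S, ∃ (k : ℕ) (s : Fin k → E) (l : Fin k → ℝ),
    0 < k ∧ (∀ j, s j ∈ Set.extremePoints ℝ S) ∧ Distinguishable S s ∧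
    (∀ j, 0 ≤ l j) ∧ (∑ j, l j = 1) ∧ (∑ j, l j • s j = x)

open Set Metric

lemma AffineMap.map_sum_smul {E F ι : Type*} [AddCommGroup E] [Module ℝ E] [AddCommGroup F]
    [Module ℝ F] [Fintype ι] (f : E →ᵃ[ℝ] F) (l : ι → ℝ) (s : ι → E) (hl : ∑ j, l j = 1) :
    f (∑ j, l j • s j) = ∑ j, l j • f (s j) := by
  have h : ∀ x, f x = f.linear x + f 0 := fun x => by
    simpa using congrFun f.decomp x
  rw [h, map_sum]
  conv_rhs => enter [2, j]; rw [h, smul_add]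
  rw [Finset.sum_add_distrib, ← Finset.sum_smul, hl, one_smul]
  simp

section Transport

variable {E F : Type*} [NormedAddCommGroup E] [NormedSpace ℝ E] [NormedAddCommGroup F]
  [NormedSpace ℝ F]

lemma AffineEquiv.image_extremePoints (T : E ≃ᵃ[ℝ] F) (S : Set E) :
    T '' extremePoints ℝ S = extremePoints ℝ (T '' S) := by
  ext b
  obtain ⟨a, rfl⟩ := T.surjective b
  have : ∀ x y, T '' openSegment ℝ x y = openSegment ℝ (T x) (T y) :=
    image_openSegment _ T.toAffineMap
  simp only [mem_extremePoints, T.surjective.forall, T.injective.mem_set_image,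
    T.injective.eq_iff, ← this]

lemma AutTransitiveOnExtreme.image {S : Set E} (h : AutTransitiveOnExtreme S) (T : E ≃ᵃ[ℝ] F) :
    AutTransitiveOnExtreme (T '' S) := by
  intro x hx y hy
  rw [← T.image_extremePoints] at hx hy
  obtain ⟨a, ha, rfl⟩ := hx
  obtain ⟨b, hb, rfl⟩ := hy
  obtain ⟨f, hf, hfa⟩ := h a ha b hb
  refine ⟨(T.symm.trans f).trans T, ?_, by simp [hfa]⟩
  ext z
  conv_rhs => rw [← hf]
  simp [Set.mem_image]

lemma DistinguishablyDecomposable.image {S : Set E} (h : DistinguishablyDecomposable S)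
    (T : E ≃ᵃ[ℝ] F) : DistinguishablyDecomposable (T '' S) := by
  rintro _ ⟨x, hx, rfl⟩
  obtain ⟨k, s, l, hk, hs, ⟨e, he0, he1, hes⟩, hl0, hl1, rfl⟩ := h x hx
  refine ⟨k, fun j => T (s j), l, hk, fun j => ?_,
    ⟨fun i => (e i).comp T.symm.toAffineMap, ?_, ?_, ?_⟩, hl0, hl1, ?_⟩
  · rw [← T.image_extremePoints]
    exact mem_image_of_mem _ (hs j)
  · rintro i _ ⟨y, hy, rfl⟩
    simpa using he0 i y hy
  · rintro _ ⟨y, hy, rfl⟩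
    simpa using he1 y hy
  · intro i
    simpa using hes i
  · exact (T.toAffineMap.map_sum_smul l s hl1).symm

lemma AffIso.of_image {S : Set E} {T : Set F} (f : E ≃ᵃ[ℝ] E) (h : AffIso (f '' S) T) :
    AffIso S T := by
  obtain ⟨g, hg, rfl⟩ := h
  refine ⟨g.comp f.toAffineMap, ?_, ?_⟩
  · intro x hx y hy hxy
    exact f.injective (hg (mem_image_of_mem _ hx) (mem_image_of_mem _ hy) hxy)
  · rw [AffineMap.coe_comp, image_comp]
    rfl

/-- An affine map that is injective on a spanning convex set is an affine equivalence. -/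
lemma AffIso.exists_affineEquiv [FiniteDimensional ℝ E] {S T : Set E} (hS : Convex ℝ S)
    (hspan : affineSpan ℝ S = ⊤) (h : AffIso S T) : ∃ f : E ≃ᵃ[ℝ] E, f '' T = S := by
  obtain ⟨f, hf, rfl⟩ := h
  obtain ⟨x, hx⟩ := hS.interior_nonempty_iff_affineSpan_eq_top.2 hspan
  have hlin : Function.Injective f.linear := by
    rw [injective_iff_map_eq_zero]
    intro v hv
    have hcont : Filter.Tendsto (fun t : ℝ => x + t • v) (nhdsWithin 0 (Ioi 0)) (nhds x) := by
      refine Filter.Tendsto.mono_left ?_ nhdsWithin_le_nhds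
      have : Continuous (fun t : ℝ => x + t • v) := by fun_prop
      simpa using this.tendsto 0
    obtain ⟨t, ht, ht0⟩ := ((hcont.eventually (mem_interior_iff_mem_nhds.1 hx)).and
      self_mem_nhdsWithin).exists
    have : x + t • v = x := hf ht (interior_subset hx) <| by
      have := f.map_vadd x (t • v)
      simpa [hv, add_comm] using this
    simpa [show t ≠ 0 from ne_of_gt ht0] using this
  have hbij : Function.Bijective f := by
    rw [← f.linear_bijective_iff]
    exact ⟨hlin, LinearMap.injective_iff_surjective.1 hlin⟩
  refine ⟨(AffineEquiv.ofBijective hbij).symm, ?_⟩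
  have h : ∀ y, (AffineEquiv.ofBijective hbij).symm (f y) = y := fun y =>
    (AffineEquiv.ofBijective hbij).symm_apply_apply y
  rw [image_image]
  simp [h]

end Transport

section Simplex

variable {E : Type*} [NormedAddCommGroup E] [NormedSpace ℝ E] {n : ℕ}

lemma AffineBasis.mem_extremePoints (b : AffineBasis (Fin n) ℝ E) (i : Fin n) :
    b i ∈ extremePoints ℝ (convexHull ℝ (range b)) := by
  refine mem_extremePoints_iff_left.2 ⟨subset_convexHull _ _ (mem_range_self i), ?_⟩
  rintro x hx y hy ⟨p, q, hp, hq, hpq, hxy⟩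
  rw [b.convexHull_eq_nonneg_coord] at hx hy
  refine b.ext_elem fun j => ?_
  have key : ∀ j, p * b.coord j x + q * b.coord j y = b.coord j (b i) := fun j => by
    have := (b.coord j).map_sum_smul ![p, q] ![x, y] (by simpa using hpq)
    simp only [Fin.sum_univ_two, Matrix.cons_val_zero, Matrix.cons_val_one, smul_eq_mul] at this
    rw [← this, hxy]
  have hne : ∀ j, j ≠ i → b.coord j x = 0 := fun j hj => by
    have h1 := key j
    rw [b.coord_apply_ne hj] at h1
    nlinarith [hx j, hy j, mul_nonneg hp.le (hx j), mul_nonneg hq.le (hy j)]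
  rcases eq_or_ne j i with rfl | hj
  · have h1 := b.sum_coord_apply_eq_one x
    rw [Finset.sum_eq_single j (fun k _ hk => hne k hk) (by simp)] at h1
    rw [h1, b.coord_apply_eq]
  · rw [hne j hj, b.coord_apply_ne hj]

lemma AffineBasis.autTransitiveOnExtreme (b : AffineBasis (Fin n) ℝ E) :
    AutTransitiveOnExtreme (convexHull ℝ (range b)) := by
  intro x hx y hy
  obtain ⟨i, rfl⟩ := extremePoints_convexHull_subset hx
  obtain ⟨j, rfl⟩ := extremePoints_convexHull_subset hy
  let f : E →ᵃ[ℝ] E :=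
    (Fintype.linearCombination ℝ (fun k => b (Equiv.swap i j k))).toAffineMap.comp b.coords
  have hf : ∀ x, f x = ∑ k, b.coord k x • b (Equiv.swap i j k) := fun x => by
    simp [f, Fintype.linearCombination_apply]
  have hfb : ∀ k, f (b k) = b (Equiv.swap i j k) := fun k => by
    rw [hf, Finset.sum_eq_single k]
    · simp
    · intro m _ hm
      simp [b.coord_apply_ne hm]
    · simp
  have hinv : Function.Involutive f := fun x => by
    rw [hf x, f.map_sum_smul _ _ (b.sum_coord_apply_eq_one x)]
    simp [hfb]
  refine ⟨AffineEquiv.ofBijective hinv.bijective, ?_, ?_⟩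
  · have : (AffineEquiv.ofBijective hinv.bijective : E → E) = f := rfl
    rw [this, f.image_convexHull, ← range_comp]
    have : f ∘ b = b ∘ Equiv.swap i j := funext hfb
    rw [this, (Equiv.swap i j).surjective.range_comp]
  · exact (hfb i).trans (by simp)

lemma AffineBasis.distinguishablyDecomposable (b : AffineBasis (Fin n) ℝ E) :
    DistinguishablyDecomposable (convexHull ℝ (range b)) := by
  intro x hx
  have hcoord := b.convexHull_eq_nonneg_coord
  refine ⟨n, b, fun i => b.coord i x, Fin.pos_iff_nonempty.2 b.nonempty, b.mem_extremePoints,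
    ⟨b.coord, fun i y hy => ?_, fun y _ => b.sum_coord_apply_eq_one y, fun i => by simp⟩,
    fun i => ?_, b.sum_coord_apply_eq_one x, by simp⟩
  · rw [hcoord] at hy
    exact hy i
  · rw [hcoord] at hx
    exact hx i

end Simplex

section Ball

variable {E : Type*} [NormedAddCommGroup E] [InnerProductSpace ℝ E]

lemma autTransitiveOnExtreme_closedBall [Nontrivial E] :
    AutTransitiveOnExtreme (closedBall (0 : E) 1) := by
  intro x hx y hy
  rw [StrictConvexSpace.extremePoints_closedBall_eq_sphere, mem_sphere_zero_iff_norm] at hx hy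
  let g : E ≃ₗᵢ[ℝ] E := (ℝ ∙ (x - y))ᗮ.reflection
  refine ⟨g.toLinearEquiv.toAffineEquiv, ?_, Submodule.reflection_sub (hx.trans hy.symm)⟩
  have h := g.image_closedBall 0 1
  rwa [map_zero] at h

lemma distinguishablyDecomposable_closedBall [Nontrivial E] :
    DistinguishablyDecomposable (closedBall (0 : E) 1) := by
  intro x hx
  rw [mem_closedBall_zero_iff] at hx
  obtain ⟨v, hv, hxv⟩ : ∃ v : E, ‖v‖ = 1 ∧ x = ‖x‖ • v := by
    rcases eq_or_ne x 0 with rfl | h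
    · obtain ⟨v, hv⟩ := NormedSpace.sphere_nonempty (x := (0 : E)) (r := 1).2 zero_le_one
      exact ⟨v, by simpa using hv, by simp⟩
    · exact ⟨‖x‖⁻¹ • x, norm_smul_inv_norm h, by simp [smul_smul, h]⟩
  have hin : ∀ y ∈ closedBall (0 : E) 1, |inner ℝ v y| ≤ 1 := fun y hy => by
    rw [mem_closedBall_zero_iff] at hy
    have := abs_real_inner_le_norm v y
    rw [hv, one_mul] at this
    exact this.trans hy
  let φ : E →ᵃ[ℝ] ℝ := (innerₗ E v).toAffineMap
  have hφ : ∀ y, φ y = inner ℝ v y := fun y => rfl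
  have hvv : inner ℝ v v = (1 : ℝ) := by simp [hv]
  refine ⟨2, ![v, -v], ![(1 + ‖x‖) / 2, (1 - ‖x‖) / 2], by norm_num, ?_,
    ⟨![(1 / 2 : ℝ) • (AffineMap.const ℝ E 1 + φ), (1 / 2 : ℝ) • (AffineMap.const ℝ E 1 - φ)],
      ?_, ?_, ?_⟩, ?_, ?_, ?_⟩
  · rw [StrictConvexSpace.extremePoints_closedBall_eq_sphere]
    simp [Fin.forall_fin_two, hv]
  · refine Fin.forall_fin_two.2 ⟨fun y hy => ?_, fun y hy => ?_⟩ <;>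
    · have := abs_le.1 (hin y hy)
      simp [hφ]
      linarith
  · intro y _
    simp [Fin.sum_univ_two, hφ]
    ring
  · refine Fin.forall_fin_two.2 ⟨?_, ?_⟩ <;> simp [hφ, hv] <;> norm_num
  · refine Fin.forall_fin_two.2 ⟨?_, ?_⟩ <;> simp <;> linarith [norm_nonneg x]
  · simp [Fin.sum_univ_two]
    ring
  · simp only [Fin.sum_univ_two, Matrix.cons_val_zero, Matrix.cons_val_one]
    rw [smul_neg, ← sub_eq_add_neg, ← sub_smul]
    conv_rhs => rw [hxv]
    ring_nf

end Ball

section Rotation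

open Filter Topology Module

variable {E : Type*} [NormedAddCommGroup E] [InnerProductSpace ℝ E]

/-- The rotation by `θ` about the axis `v 0`, for an orthonormal frame `v`. -/
def frameRotation (v : Fin 3 → E) (θ : ℝ) (x : E) : E :=
  inner ℝ (v 0) x • v 0
    + (Real.cos θ * inner ℝ (v 1) x - Real.sin θ * inner ℝ (v 2) x) • v 1
    + (Real.sin θ * inner ℝ (v 1) x + Real.cos θ * inner ℝ (v 2) x) • v 2

lemma exists_cos_sin_eq {p q : ℝ} (h : p ^ 2 + q ^ 2 = 1) :
    ∃ θ : ℝ, |θ| ≤ Real.pi ∧ Real.cos θ = p ∧ Real.sin θ = q := by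
  let z : ℂ := ⟨p, q⟩
  have hz : ‖z‖ = 1 := by
    rw [← sq_eq_sq₀ (norm_nonneg _) zero_le_one, Complex.sq_norm, Complex.normSq_mk]
    linarith
  have hz0 : z ≠ 0 := by
    rw [← norm_ne_zero_iff, hz]
    exact one_ne_zero
  exact ⟨z.arg, Complex.abs_arg_le_pi z, by rw [Complex.cos_arg hz0, hz, div_one],
    by rw [Complex.sin_arg, hz, div_one]⟩

lemma Orthonormal.inner_frame {v : Fin 3 → E} (hv : Orthonormal ℝ v) :
    (∀ i, inner ℝ (v i) (v i) = (1 : ℝ)) ∧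
      inner ℝ (v 0) (v 1) = (0 : ℝ) ∧ inner ℝ (v 0) (v 2) = (0 : ℝ) ∧
      inner ℝ (v 1) (v 0) = (0 : ℝ) ∧ inner ℝ (v 1) (v 2) = (0 : ℝ) ∧
      inner ℝ (v 2) (v 0) = (0 : ℝ) ∧ inner ℝ (v 2) (v 1) = (0 : ℝ) := by
  have h := orthonormal_iff_ite.1 hv
  refine ⟨fun i => by simpa using h i i, ?_, ?_, ?_, ?_, ?_, ?_⟩
  all_goals first
    | simpa using h 0 1 | simpa using h 0 2 | simpa using h 1 0
    | simpa using h 1 2 | simpa using h 2 0 | simpa using h 2 1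

lemma Orthonormal.inner_frameRotation {v : Fin 3 → E} (hv : Orthonormal ℝ v) (θ : ℝ) (x : E) :
    inner ℝ (v 0) (frameRotation v θ x) = inner ℝ (v 0) x ∧
    inner ℝ (v 1) (frameRotation v θ x)
      = Real.cos θ * inner ℝ (v 1) x - Real.sin θ * inner ℝ (v 2) x ∧
    inner ℝ (v 2) (frameRotation v θ x)
      = Real.sin θ * inner ℝ (v 1) x + Real.cos θ * inner ℝ (v 2) x := by
  obtain ⟨h, h01, h02, h10, h12, h20, h21⟩ := hv.inner_frame
  simp only [frameRotation, inner_add_right, real_inner_smul_right, h, h01, h02, h10, h12, h20, h21]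
  refine ⟨?_, ?_, ?_⟩ <;> ring

lemma Orthonormal.frameRotation_add {v : Fin 3 → E} (hv : Orthonormal ℝ v) (α β : ℝ) (x : E) :
    frameRotation v α (frameRotation v β x) = frameRotation v (α + β) x := by
  obtain ⟨h0, h1, h2⟩ := hv.inner_frameRotation β x
  conv_lhs => rw [frameRotation]
  rw [h0, h1, h2, frameRotation, Real.cos_add, Real.sin_add]
  module

lemma continuous_frameRotation (x : E) :
    Continuous fun p : (Fin 3 → E) × ℝ => frameRotation p.1 p.2 x := by
  unfold frameRotation
  fun_prop

variable [FiniteDimensional ℝ E]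

lemma Orthonormal.exists_basis_eq (hE : finrank ℝ E = 3) {v : Fin 3 → E} (hv : Orthonormal ℝ v) :
    ∃ b : OrthonormalBasis (Fin 3) ℝ E, ⇑b = v := by
  obtain ⟨b, hb⟩ := Orthonormal.exists_orthonormalBasis_extension_of_card_eq (𝕜 := ℝ) (ι := Fin 3)
    (by simpa using hE) (v := v) (s := Set.univ) (hv.comp _ Subtype.val_injective)
  exact ⟨b, funext fun i => hb i (mem_univ i)⟩

lemma Orthonormal.sum_frame (hE : finrank ℝ E = 3) {v : Fin 3 → E} (hv : Orthonormal ℝ v) (x : E) :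
    x = inner ℝ (v 0) x • v 0 + inner ℝ (v 1) x • v 1 + inner ℝ (v 2) x • v 2 := by
  obtain ⟨b, rfl⟩ := hv.exists_basis_eq hE
  rw [← Fin.sum_univ_three (fun i => inner ℝ (b i) x • b i), b.sum_repr']

lemma Orthonormal.inner_frame_eq (hE : finrank ℝ E = 3)
    {v : Fin 3 → E} (hv : Orthonormal ℝ v) (x y : E) :
    inner ℝ x y = inner ℝ (v 0) x * inner ℝ (v 0) y + inner ℝ (v 1) x * inner ℝ (v 1) y
      + inner ℝ (v 2) x * inner ℝ (v 2) y := by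
  obtain ⟨b, rfl⟩ := hv.exists_basis_eq hE
  rw [← b.sum_inner_mul_inner, Fin.sum_univ_three]
  simp only [real_inner_comm]

/-- Two vectors of equal norm and equal axial component differ by a rotation about the axis. -/
lemma Orthonormal.exists_frameRotation_eq (hE : finrank ℝ E = 3)
    {v : Fin 3 → E} (hv : Orthonormal ℝ v) {x y : E}
    (hn : ‖x‖ = ‖y‖) (h : inner ℝ (v 0) x = inner ℝ (v 0) y) :
    ∃ t : ℝ, 0 ≤ t ∧ frameRotation v t x = y := by
  have hxy : inner ℝ x x = inner ℝ y y := by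
    rw [real_inner_self_eq_norm_sq, real_inner_self_eq_norm_sq, hn]
  rw [hv.inner_frame_eq hE x x, hv.inner_frame_eq hE y y, h] at hxy
  conv => enter [1, t, 2]; rw [hv.sum_frame hE y, frameRotation, h]
  set a := inner ℝ (v 1) x
  set b := inner ℝ (v 2) x
  set c := inner ℝ (v 1) y
  set d := inner ℝ (v 2) y
  have hab : a ^ 2 + b ^ 2 = c ^ 2 + d ^ 2 := by linarith
  rcases eq_or_ne (a ^ 2 + b ^ 2) 0 with h0 | h0
  · have ha : a = 0 := by nlinarith [sq_nonneg a, sq_nonneg b]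
    have hb : b = 0 := by nlinarith [sq_nonneg a, sq_nonneg b]
    have hc : c = 0 := by nlinarith [sq_nonneg c, sq_nonneg d]
    have hd : d = 0 := by nlinarith [sq_nonneg c, sq_nonneg d]
    exact ⟨0, le_rfl, by simp [ha, hb, hc, hd]⟩
  · obtain ⟨θ, hθ, hcos, hsin⟩ := exists_cos_sin_eq
      (p := (a * c + b * d) / (a ^ 2 + b ^ 2)) (q := (a * d - b * c) / (a ^ 2 + b ^ 2)) (by
        field_simp
        linear_combination (-(a ^ 2 + b ^ 2)) * hab)
    refine ⟨θ + 2 * Real.pi, by linarith [neg_abs_le θ, Real.pi_pos], ?_⟩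
    rw [Real.cos_add_two_pi, Real.sin_add_two_pi, hcos, hsin]
    congr 3
    · field_simp
      ring
    · field_simp
      ring

/-- A linear isometry of a three-dimensional space that is close to the identity has a
nonzero fixed vector. -/
lemma LinearIsometryEquiv.exists_fixed (hE : finrank ℝ E = 3)
    (g : E ≃ₗᵢ[ℝ] E) (hg : ∀ x, ‖g x - x‖ ≤ ‖x‖ / 2) :
    ∃ u : E, ‖u‖ = 1 ∧ g u = u := by
  let b : OrthonormalBasis (Fin 3) ℝ E := (stdOrthonormalBasis ℝ E).reindex (finCongr hE)
  let L : E →ₗ[ℝ] E := g.toLinearEquiv.toLinearMap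
  let A : Matrix (Fin 3) (Fin 3) ℝ := LinearMap.toMatrix b.toBasis b.toBasis L
  have hL : LinearMap.adjoint L ∘ₗ L = LinearMap.id := by
    refine LinearMap.ext fun x => ext_inner_right ℝ fun y => ?_
    rw [LinearMap.comp_apply, LinearMap.adjoint_inner_left]
    exact g.inner_map_map x y
  have hA : A.transpose * A = 1 := by
    have h := congrArg (LinearMap.toMatrix b.toBasis b.toBasis) hL
    rw [LinearMap.toMatrix_comp b.toBasis b.toBasis b.toBasis, LinearMap.toMatrix_adjoint,
      LinearMap.toMatrix_id] at h
    simpa using h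
  have hsub : LinearMap.toMatrix b.toBasis b.toBasis (L - LinearMap.id) = A - 1 := by
    rw [eq_sub_iff_add_eq, ← LinearMap.toMatrix_id b.toBasis, ← LinearEquiv.map_add, sub_add_cancel]
  have hadd : LinearMap.toMatrix b.toBasis b.toBasis (L + LinearMap.id) = A + 1 := by
    rw [LinearEquiv.map_add, LinearMap.toMatrix_id]
  have hdadd : (A + 1).det ≠ 0 := by
    rw [← hadd, LinearMap.det_toMatrix]
    intro h0
    obtain ⟨x, hx, hx0⟩ := (Submodule.ne_bot_iff _).1 (LinearMap.bot_lt_ker_of_det_eq_zero h0).ne'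
    have hgx : g x = -x := by
      have : g x + x = 0 := hx
      exact eq_neg_of_add_eq_zero_left this
    have h1 := hg x
    rw [hgx, ← neg_add', norm_neg, ← two_smul ℝ x, norm_smul] at h1
    have := norm_pos_iff.2 hx0
    norm_num at h1
    linarith
  have hd1 : A.det = 1 := by
    have h : A.transpose * (A + 1) = (A + 1).transpose := by
      rw [mul_add, hA, mul_one, Matrix.transpose_add, Matrix.transpose_one, add_comm]
    have h := congrArg Matrix.det h
    rw [Matrix.det_mul, Matrix.det_transpose, Matrix.det_transpose] at h
    exact mul_right_cancel₀ hdadd (h.trans (one_mul _).symm)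
  have hd0 : LinearMap.det (L - LinearMap.id) = 0 := by
    rw [← LinearMap.det_toMatrix b.toBasis, hsub]
    have h : A.transpose * (A - 1) = -(A - 1).transpose := by
      rw [mul_sub, hA, mul_one, Matrix.transpose_sub, Matrix.transpose_one, neg_sub]
    have h := congrArg Matrix.det h
    rw [Matrix.det_mul, Matrix.det_neg, Matrix.det_transpose, Matrix.det_transpose, hd1] at h
    norm_num at h
    linarith
  obtain ⟨x, hx, hx0⟩ := (Submodule.ne_bot_iff _).1 (LinearMap.bot_lt_ker_of_det_eq_zero hd0).ne'
  have hgx : g x = x := sub_eq_zero.1 hx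
  exact ⟨‖x‖⁻¹ • x, norm_smul_inv_norm hx0, by rw [map_smul, hgx]⟩

lemma LinearIsometryEquiv.exists_frameRotation (hE : finrank ℝ E = 3) (g : E ≃ₗᵢ[ℝ] E)
    (hg : ∀ x, ‖g x - x‖ ≤ ‖x‖ / 2) (hg1 : ∃ x, g x ≠ x) :
    ∃ (v : Fin 3 → E) (θ : ℝ), Orthonormal ℝ v ∧ 0 < θ ∧ θ ≤ Real.pi ∧
      ∀ x, g x = frameRotation v θ x := by
  obtain ⟨u, hu, hgu⟩ := g.exists_fixed hE hg
  obtain ⟨b, hb⟩ := Orthonormal.exists_orthonormalBasis_extension_of_card_eq (𝕜 := ℝ) (ι := Fin 3)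
    (by simpa using hE) (v := fun _ => u) (s := {0}) (by
      rw [orthonormal_iff_ite]
      rintro ⟨i, rfl⟩ ⟨j, rfl⟩
      simp [hu])
  have hb0 : b 0 = u := hb 0 rfl
  have hgb0 : g (b 0) = b 0 := by rw [hb0, hgu]
  have hv := b.orthonormal
  obtain ⟨h, h01, h02, h10, h12, h20, h21⟩ := hv.inner_frame
  have hinv : ∀ x, inner ℝ (b 0) (g x) = inner ℝ (b 0) x := fun x => by
    conv_lhs => rw [← hgb0]
    exact g.inner_map_map _ _
  have hclose : ∀ i, 1 / 2 ≤ inner ℝ (b i) (g (b i)) := fun i => by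
    have h1 := (abs_real_inner_le_norm (b i) (g (b i) - b i)).trans
      (mul_le_mul_of_nonneg_left (hg (b i)) (norm_nonneg _))
    rw [inner_sub_right, h i, b.norm_eq_one i] at h1
    linarith [(abs_le.1 h1).1]
  have e11 := hv.inner_frame_eq hE (g (b 1)) (g (b 1))
  have e22 := hv.inner_frame_eq hE (g (b 2)) (g (b 2))
  have e12 := hv.inner_frame_eq hE (g (b 1)) (g (b 2))
  simp only [g.inner_map_map, hinv, h, h01, h02, h12] at e11 e22 e12
  have hp := hclose 1
  have hs := hclose 2
  obtain ⟨p, hpd⟩ : ∃ p : ℝ, inner ℝ (b 1) (g (b 1)) = p := ⟨_, rfl⟩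
  obtain ⟨q, hqd⟩ : ∃ q : ℝ, inner ℝ (b 2) (g (b 1)) = q := ⟨_, rfl⟩
  obtain ⟨r, hrd⟩ : ∃ r : ℝ, inner ℝ (b 1) (g (b 2)) = r := ⟨_, rfl⟩
  obtain ⟨s, hsd⟩ : ∃ s : ℝ, inner ℝ (b 2) (g (b 2)) = s := ⟨_, rfl⟩
  rw [hpd, hqd] at e11
  rw [hrd, hsd] at e22
  rw [hpd, hqd, hrd, hsd] at e12
  rw [hpd] at hp
  rw [hsd] at hs
  have hsp : s = p := by
    have : (s - p) * (s + p) = 0 := by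
      have h1 : p ^ 2 * r ^ 2 = q ^ 2 * s ^ 2 := by
        have : p * r = -(q * s) := by linarith
        rw [← mul_pow, this]
        ring
      linear_combination s ^ 2 * e11 - p ^ 2 * e22 - h1
    rcases mul_eq_zero.1 this with h | h <;> linarith
  have hrq : r = -q := by
    rw [hsp] at e12
    have : p * (r + q) = 0 := by linarith
    rcases mul_eq_zero.1 this with h | h <;> linarith
  have hrot : ∀ x, g x = inner ℝ (b 0) x • b 0
      + (p * inner ℝ (b 1) x - q * inner ℝ (b 2) x) • b 1
      + (q * inner ℝ (b 1) x + p * inner ℝ (b 2) x) • b 2 := fun x => by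
    have h1 : g (b 1) = p • b 1 + q • b 2 := by
      conv_lhs => rw [hv.sum_frame hE (g (b 1))]
      rw [hinv, h01, hpd, hqd, zero_smul, zero_add]
    have h2 : g (b 2) = (-q) • b 1 + p • b 2 := by
      conv_lhs => rw [hv.sum_frame hE (g (b 2))]
      rw [hinv, h02, hrd, hsd, zero_smul, zero_add, hrq, hsp]
    conv_lhs => rw [hv.sum_frame hE x]
    rw [map_add, map_add, map_smul, map_smul, map_smul, hgb0, h1, h2]
    module
  obtain ⟨θ, hθ, hc, hs⟩ := exists_cos_sin_eq (p := p) (q := q) (by linarith)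
  have hθ0 : θ ≠ 0 := by
    rintro rfl
    obtain ⟨x, hx⟩ := hg1
    refine hx ?_
    rw [hrot x, ← hc, ← hs]
    simpa using (hv.sum_frame hE x).symm
  rcases lt_or_gt_of_ne hθ0 with hneg | hpos
  · refine ⟨b ∘ Equiv.swap 1 2, -θ, hv.comp _ (Equiv.swap 1 2).injective, by linarith,
      by rwa [abs_of_neg hneg] at hθ, fun x => ?_⟩
    have e0 : (b ∘ Equiv.swap 1 2) 0 = b 0 := by
      simp [Equiv.swap_apply_of_ne_of_ne (show (0 : Fin 3) ≠ 1 by decide)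
        (show (0 : Fin 3) ≠ 2 by decide)]
    have e1 : (b ∘ Equiv.swap 1 2) 1 = b 2 := by simp
    have e2 : (b ∘ Equiv.swap 1 2) 2 = b 1 := by simp
    rw [frameRotation, e0, e1, e2, hrot x, ← hc, ← hs, Real.cos_neg, Real.sin_neg]
    module
  · exact ⟨b, θ, hv, hpos, by rwa [abs_of_pos hpos] at hθ, fun x => by
      rw [hrot x, ← hc, ← hs, frameRotation]⟩

/-- If a closed subset of the unit sphere has nontrivial symmetries arbitrarily close to the
identity, then it is invariant under all rotations about some axis. -/
lemma exists_axis_of_small_symmetries (hE : finrank ℝ E = 3) {X : Set E} (hX : IsClosed X)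
    (hG : ∀ ε > 0, ∃ g : E ≃ₗᵢ[ℝ] E, (∃ x, g x ≠ x) ∧ (∀ x, ‖g x - x‖ ≤ ε * ‖x‖) ∧
      MapsTo g X X) :
    ∃ u : E, ‖u‖ = 1 ∧ ∀ x ∈ X, ∀ y, ‖y‖ = ‖x‖ → inner ℝ u y = inner ℝ u x → y ∈ X := by
  have hseq : ∀ n : ℕ, ∃ (v : Fin 3 → E) (θ : ℝ), Orthonormal ℝ v ∧ 0 < θ ∧ θ ≤ Real.pi ∧
      1 - 1 / ((n : ℝ) + 2) ≤ Real.cos θ ∧ ∀ x ∈ X, frameRotation v θ x ∈ X := fun n => by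
    have hε : (0 : ℝ) < 1 / ((n : ℝ) + 2) := by positivity
    obtain ⟨g, hg1, hg, hgX⟩ := hG _ hε
    have hε2 : 1 / ((n : ℝ) + 2) ≤ 1 / 2 := by
      apply one_div_le_one_div_of_le <;> linarith [(Nat.cast_nonneg n : (0 : ℝ) ≤ n)]
    obtain ⟨v, θ, hv, h0, hpi, hrot⟩ := g.exists_frameRotation hE (fun x => (hg x).trans
      (by nlinarith [norm_nonneg x])) hg1
    refine ⟨v, θ, hv, h0, hpi, ?_, fun x hx => hrot x ▸ hgX hx⟩
    obtain ⟨h, h01, h02, h10, h12, h20, h21⟩ := hv.inner_frame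
    have h1 := (abs_real_inner_le_norm (v 1) (g (v 1) - v 1)).trans
      (mul_le_mul_of_nonneg_left (hg (v 1)) (norm_nonneg _))
    rw [inner_sub_right, hrot, (hv.inner_frameRotation θ (v 1)).2.1, h, h21, hv.norm_eq_one] at h1
    linarith [(abs_le.1 h1).1]
  choose v θ hv hθ0 hθpi hcos hmaps using hseq
  have hθ : Tendsto θ atTop (𝓝 0) := by
    have h1 : Tendsto (fun n : ℕ => 1 - 1 / ((n : ℝ) + 2)) atTop (𝓝 1) := by
      have : Tendsto (fun n : ℕ => 1 / ((n : ℝ) + 2)) atTop (𝓝 0) := by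
        refine tendsto_const_nhds.div_atTop ?_
        exact tendsto_atTop_add_const_right _ _ tendsto_natCast_atTop_atTop
      simpa using this.const_sub 1
    have h2 : Tendsto (fun n => Real.cos (θ n)) atTop (𝓝 1) :=
      tendsto_of_tendsto_of_tendsto_of_le_of_le h1 tendsto_const_nhds hcos
        (fun n => Real.cos_le_one _)
    have h3 := (Real.continuous_arccos.tendsto 1).comp h2
    rw [Real.arccos_one] at h3
    refine h3.congr fun n => ?_
    exact Real.arccos_cos (hθ0 n).le (hθpi n)
  have hcompact : IsCompact {w : Fin 3 → E | Orthonormal ℝ w} := by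
    refine Metric.isCompact_of_isClosed_isBounded ?_ ?_
    · simp only [orthonormal_iff_ite, Set.ofPred_forall]
      exact isClosed_iInter fun i => isClosed_iInter fun j =>
        isClosed_eq (by fun_prop) continuous_const
    · refine (Metric.isBounded_closedBall (x := (0 : Fin 3 → E)) (r := 1)).subset fun w hw => ?_
      rw [mem_closedBall_zero_iff, pi_norm_le_iff_of_nonneg zero_le_one]
      exact fun i => (hw.norm_eq_one i).le
  obtain ⟨w, hw, φ, hφ, hlim⟩ := hcompact.tendsto_subseq hv
  refine ⟨w 0, hw.norm_eq_one 0, fun x hx y hxy hinner => ?_⟩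
  obtain ⟨t, ht0, rfl⟩ := Orthonormal.exists_frameRotation_eq hE hw hxy.symm hinner.symm
  have hpow : ∀ n k : ℕ, frameRotation (v n) (k * θ n) x ∈ X := fun n k => by
    induction k with
    | zero => simpa [frameRotation, ← (hv n).sum_frame hE x] using hx
    | succ k ih =>
      have := hmaps n _ ih
      rw [(hv n).frameRotation_add] at this
      convert this using 2
      push_cast
      ring
  have hfloor : Tendsto (fun n => (⌊t / θ n⌋₊ : ℝ) * θ n) atTop (𝓝 t) := by
    have h1 : Tendsto (fun n => t - θ n) atTop (𝓝 t) := by simpa using hθ.const_sub t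
    refine tendsto_of_tendsto_of_tendsto_of_le_of_le h1 tendsto_const_nhds (fun n => ?_)
      (fun n => ?_)
    · have h2 := mul_lt_mul_of_pos_right (Nat.lt_floor_add_one (t / θ n)) (hθ0 n)
      rw [div_mul_cancel₀ _ (hθ0 n).ne'] at h2
      simp only
      linarith
    · have h2 := mul_le_mul_of_nonneg_right (Nat.floor_le (div_nonneg ht0 (hθ0 n).le)) (hθ0 n).le
      rwa [div_mul_cancel₀ _ (hθ0 n).ne'] at h2
  refine hX.mem_of_tendsto (((continuous_frameRotation x).tendsto (w, t)).comp
    (hlim.prodMk_nhds (hfloor.comp hφ.tendsto_atTop))) (Eventually.of_forall fun n => ?_)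
  exact hpow (φ n) _

end Rotation

section AxialSymmetry

open Filter Topology Module

variable {E : Type*} [NormedAddCommGroup E] [InnerProductSpace ℝ E]

/-- `X` is a union of circles about the axis `u`. -/
def AxiallySymmetric (X : Set E) (u : E) : Prop :=
  ∀ x ∈ X, ∀ y, ‖y‖ = ‖x‖ → inner ℝ u y = inner ℝ u x → y ∈ X

lemma AxiallySymmetric.neg {X : Set E} {u : E} (h : AxiallySymmetric X u) :
    AxiallySymmetric X (-u) := fun x hx y hn hi => h x hx y hn (by simpa using hi)

lemma AxiallySymmetric.map {X : Set E} {u : E} (h : AxiallySymmetric X u) (g : E ≃ₗᵢ[ℝ] E)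
    (hg : g '' X = X) : AxiallySymmetric X (g u) := by
  intro x hx y hn hi
  rw [← hg] at hx
  obtain ⟨x, hx, rfl⟩ := hx
  have := h x hx (g.symm y) (by simpa using hn)
    (by rw [← g.inner_map_map, g.apply_symm_apply, hi, g.inner_map_map])
  rw [← hg]
  exact ⟨_, this, g.apply_symm_apply y⟩

variable [FiniteDimensional ℝ E]

lemma Orthonormal.norm_frameRotation (hE : finrank ℝ E = 3)
    {v : Fin 3 → E} (hv : Orthonormal ℝ v) (θ : ℝ) (x : E) :
    ‖frameRotation v θ x‖ = ‖x‖ := by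
  obtain ⟨h0, h1, h2⟩ := hv.inner_frameRotation θ x
  rw [← sq_eq_sq₀ (norm_nonneg _) (norm_nonneg _), ← real_inner_self_eq_norm_sq,
    ← real_inner_self_eq_norm_sq, hv.inner_frame_eq hE, hv.inner_frame_eq hE x, h0, h1, h2]
  linear_combination (inner ℝ (v 1) x ^ 2 + inner ℝ (v 2) x ^ 2) * Real.sin_sq_add_cos_sq θ

lemma exists_frame_of_ne (hE : finrank ℝ E = 3)
    {u v : E} (hu : ‖u‖ = 1) (hv : ‖v‖ = 1) (h1 : u ≠ v) (h2 : u ≠ -v) :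
    ∃ (w : Fin 3 → E) (c s : ℝ), Orthonormal ℝ w ∧ w 0 = v ∧ 0 < s ∧ c ^ 2 + s ^ 2 = 1 ∧
      u = c • w 0 + s • w 1 := by
  set c : ℝ := inner ℝ v u
  have hvv : inner ℝ v v = (1 : ℝ) := by simp [hv]
  have huu : inner ℝ u u = (1 : ℝ) := by simp [hu]
  have hs : u - c • v ≠ 0 := by
    intro h
    have hcv : u = c • v := sub_eq_zero.1 h
    have : |c| = 1 := by
      have := congrArg norm hcv
      rw [norm_smul, hu, hv, mul_one] at this
      exact this.symm
    rcases eq_or_eq_neg_of_abs_eq this with h | h <;> rw [h] at hcv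
    · exact h1 (by simpa using hcv)
    · exact h2 (by simpa using hcv)
  set s : ℝ := ‖u - c • v‖
  have hs0 : 0 < s := norm_pos_iff.2 hs
  have hs2 : s ^ 2 = 1 - c ^ 2 := by
    have hcu : inner ℝ u v = c := real_inner_comm v u
    rw [← real_inner_self_eq_norm_sq, inner_sub_left, inner_sub_right, inner_sub_right,
      real_inner_smul_left, real_inner_smul_left, real_inner_smul_right, real_inner_smul_right,
      huu, hvv, hcu]
    change 1 - c * c - (c * c - c * (c * 1)) = 1 - c ^ 2
    ring
  have hperp : inner ℝ v (s⁻¹ • (u - c • v)) = (0 : ℝ) := by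
    rw [real_inner_smul_right, inner_sub_right, real_inner_smul_right, hvv]
    change s⁻¹ * (c - c * 1) = 0
    ring
  have hperp' : inner ℝ (s⁻¹ • (u - c • v)) v = (0 : ℝ) := by rw [real_inner_comm, hperp]
  have hnorm : ‖s⁻¹ • (u - c • v)‖ = 1 := norm_smul_inv_norm hs
  obtain ⟨b, hb⟩ := Orthonormal.exists_orthonormalBasis_extension_of_card_eq (𝕜 := ℝ) (ι := Fin 3)
    (by simpa using hE) (v := ![v, s⁻¹ • (u - c • v), 0]) (s := {0, 1}) (by
      rw [orthonormal_iff_ite]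
      rintro ⟨i, rfl | rfl⟩ ⟨j, rfl | rfl⟩
      · simp [hv]
      · exact hperp.trans (if_neg fun h => zero_ne_one (congrArg Subtype.val h)).symm
      · exact hperp'.trans (if_neg fun h => one_ne_zero (congrArg Subtype.val h)).symm
      · exact ((real_inner_self_eq_norm_sq _).trans
          ((congrArg (· ^ 2) hnorm).trans (one_pow 2))).trans (if_pos rfl).symm)
  have hb0 : b 0 = v := hb 0 (by simp)
  have hb1 : b 1 = s⁻¹ • (u - c • v) := hb 1 (by simp)
  refine ⟨b, c, s, b.orthonormal, hb0, hs0, by linarith, ?_⟩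
  rw [hb0, hb1, smul_smul, mul_inv_cancel₀ hs0.ne', one_smul, add_sub_cancel]

lemma AxiallySymmetric.mem_of_inner_le (hE : finrank ℝ E = 3)
    {X : Set E} (hX : IsCompact X) (hX1 : ∀ x ∈ X, ‖x‖ = 1)
    {u v : E} (hu : ‖u‖ = 1) (hv : ‖v‖ = 1) (h1 : u ≠ v) (h2 : u ≠ -v)
    (hXu : AxiallySymmetric X u) (hXv : AxiallySymmetric X v) {x y : E} (hx : x ∈ X)
    (hy : ‖y‖ = 1) (hxy : inner ℝ u x ≤ inner ℝ u y) : y ∈ X := by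
  obtain ⟨w, c, s, hw, rfl, hs, hcs, hu_eq⟩ := exists_frame_of_ne hE hu hv h1 h2
  obtain ⟨hww, h01, h02, h10, h12, h20, h21⟩ := hw.inner_frame
  have hle : ∀ z : E, ‖z‖ = 1 → |inner ℝ u z| ≤ 1 := fun z hz => by
    simpa [hu, hz] using abs_real_inner_le_norm u z
  let H : Set ℝ := (fun z => inner ℝ u z) '' X
  have hH : IsClosed H := (hX.image (by fun_prop)).isClosed
  have hIcc : Icc (inner ℝ u x) 1 ⊆ H := by
    refine IsClosed.Icc_subset_of_forall_exists_gt (hH.inter isClosed_Icc)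
      (mem_image_of_mem _ hx) ?_
    rintro h ⟨⟨z, hz, rfl⟩, -, hlt⟩ m hm
    simp only at hlt hm ⊢
    have hge := (abs_le.1 (hle z (hX1 z hz))).1
    obtain ⟨h, hh⟩ : ∃ h : ℝ, inner ℝ u z = h := ⟨_, rfl⟩
    rw [hh] at hlt hge hm ⊢
    have hh2 : 0 ≤ 1 - h ^ 2 := by nlinarith
    let z' : E := (h * c) • w 0 + (h * s) • w 1 + √(1 - h ^ 2) • w 2
    have hz0 : inner ℝ (w 0) z' = h * c := by
      simp only [z', inner_add_right, real_inner_smul_right, hww, h01, h02]; ring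
    have hz1 : inner ℝ (w 1) z' = h * s := by
      simp only [z', inner_add_right, real_inner_smul_right, hww, h10, h12]; ring
    have hz2 : inner ℝ (w 2) z' = √(1 - h ^ 2) := by
      simp only [z', inner_add_right, real_inner_smul_right, hww, h20, h21]; ring
    have hin : ∀ y : E, inner ℝ u y = c * inner ℝ (w 0) y + s * inner ℝ (w 1) y := fun y => by
      rw [hu_eq, inner_add_left, real_inner_smul_left, real_inner_smul_left]
    have huz' : inner ℝ u z' = h := by
      rw [hin, hz0, hz1]
      linear_combination h * hcs
    have hz'n : ‖z'‖ = 1 := by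
      rw [← sq_eq_sq₀ (norm_nonneg _) zero_le_one, ← real_inner_self_eq_norm_sq,
        hw.inner_frame_eq hE, hz0, hz1, hz2, Real.mul_self_sqrt hh2]
      linear_combination h ^ 2 * hcs
    have hz' : z' ∈ X := hXu z hz z' (by rw [hz'n, hX1 z hz]) (by rw [huz', hh])
    have hc1 : h ^ 2 * c ^ 2 ≤ 1 := by nlinarith [sq_nonneg h, sq_nonneg s]
    let ρ : ℝ := √(1 - (h * c) ^ 2)
    have hρ2 : ρ ^ 2 = 1 - (h * c) ^ 2 := Real.sq_sqrt (by rw [mul_pow]; linarith)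
    have hρ : h * s < ρ := by
      by_contra hcon
      have hcon := not_lt.1 hcon
      have hρ0 : 0 ≤ ρ := Real.sqrt_nonneg _
      have h3 : ρ ^ 2 ≤ (h * s) ^ 2 := pow_le_pow_left₀ hρ0 hcon 2
      have h4 : 1 ≤ h ^ 2 := by
        rw [hρ2] at h3
        have : (h * s) ^ 2 + (h * c) ^ 2 = h ^ 2 := by linear_combination h ^ 2 * hcs
        linarith
      have h5 : h = -1 := by nlinarith
      rw [h5] at hcon
      linarith
    let y' : E := (h * c) • w 0 + ρ • w 1
    have hy0 : inner ℝ (w 0) y' = h * c := by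
      simp only [y', inner_add_right, real_inner_smul_right, hww, h01]; ring
    have hy1 : inner ℝ (w 1) y' = ρ := by
      simp only [y', inner_add_right, real_inner_smul_right, hww, h10]; ring
    have hy2 : inner ℝ (w 2) y' = 0 := by
      simp only [y', inner_add_right, real_inner_smul_right, h20, h21]; ring
    have hy'n : ‖y'‖ = 1 := by
      rw [← sq_eq_sq₀ (norm_nonneg _) zero_le_one, ← real_inner_self_eq_norm_sq,
        hw.inner_frame_eq hE, hy0, hy1, hy2]
      linear_combination hρ2
    have huy' : h < inner ℝ u y' := by
      rw [hin, hy0, hy1]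
      nlinarith [mul_lt_mul_of_pos_left hρ hs]
    obtain ⟨t, ht0, ht⟩ := hw.exists_frameRotation_eq hE (hz'n.trans hy'n.symm)
      (hz0.trans hy0.symm)
    have hcont : Continuous fun t => inner ℝ u (frameRotation w t z') :=
      continuous_const.inner
        ((continuous_frameRotation z').comp (continuous_const.prodMk continuous_id))
    have hstart : frameRotation w 0 z' = z' := by
      simpa [frameRotation] using (hw.sum_frame hE z').symm
    obtain ⟨τ, -, hτ⟩ := intermediate_value_Icc ht0 hcont.continuousOn
      (show min m (inner ℝ u y') ∈ _ by
        rw [hstart, ht, huz']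
        exact ⟨le_min (le_of_lt hm) huy'.le, min_le_right _ _⟩)
    have hmem : frameRotation w τ z' ∈ X :=
      hXv z' hz' _ (hw.norm_frameRotation hE τ z') (hw.inner_frameRotation τ z').1
    exact ⟨min m (inner ℝ u y'), ⟨_, hmem, hτ⟩, lt_min hm huy', min_le_left _ _⟩
  obtain ⟨z, hz, hzy⟩ := hIcc ⟨hxy, (abs_le.1 (hle y hy)).2⟩
  exact hXu z hz y (by rw [hy, hX1 z hz]) hzy.symm

/-- A nonempty compact subset of the unit sphere that is symmetric about two different axes is
the whole sphere. -/
lemma AxiallySymmetric.sphere_subset (hE : finrank ℝ E = 3)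
    {X : Set E} (hX : IsCompact X) (hX1 : ∀ x ∈ X, ‖x‖ = 1)
    (hne : X.Nonempty) {u v : E} (hu : ‖u‖ = 1) (hv : ‖v‖ = 1) (h1 : u ≠ v) (h2 : u ≠ -v)
    (hXu : AxiallySymmetric X u) (hXv : AxiallySymmetric X v) : sphere 0 1 ⊆ X := by
  obtain ⟨x, hx⟩ := hne
  intro y hy
  rw [mem_sphere_zero_iff_norm] at hy
  rcases le_total (inner ℝ u x) (inner ℝ u y : ℝ) with h | h
  · exact AxiallySymmetric.mem_of_inner_le hE hX hX1 hu hv h1 h2 hXu hXv hx hy h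
  · refine AxiallySymmetric.mem_of_inner_le hE hX hX1 (by rwa [norm_neg]) hv
      (fun h => h2 (by rw [← h, neg_neg])) (fun h => h1 (neg_injective h)) hXu.neg hXv hx hy ?_
    simpa using h

end AxialSymmetry

section Cylinder

variable {E : Type*} [NormedAddCommGroup E] [InnerProductSpace ℝ E]

/-- A cylinder over a disc is not distinguishably decomposable. -/
lemma not_distinguishablyDecomposable_cylinder {S : Set E} (hS : Convex ℝ S) {u : E}
    (hu : ‖u‖ = 1) {c : ℝ} (hc : 0 < c) (hc1 : c < 1) (hne : (extremePoints ℝ S).Nonempty)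
    (hX : ∀ x, x ∈ extremePoints ℝ S ↔ ‖x‖ = 1 ∧ (inner ℝ u x = c ∨ inner ℝ u x = -c)) :
    ¬ DistinguishablyDecomposable S := by
  intro hD
  have huu : inner ℝ u u = (1 : ℝ) := by simp [hu]
  -- horizontal parts of extreme points
  have hV : ∀ x ∈ extremePoints ℝ S, ‖x - (inner ℝ u x : ℝ) • u‖ ^ 2 = 1 - c ^ 2 := fun x hx => by
    obtain ⟨hn, hi⟩ := (hX x).1 hx
    have hsq : (inner ℝ u x : ℝ) ^ 2 = c ^ 2 := by rcases hi with h | h <;> rw [h]; ring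
    rw [norm_sub_sq_real, hn, norm_smul, hu, real_inner_smul_right, real_inner_comm u x, mul_one,
      Real.norm_eq_abs, sq_abs, hsq]
    linear_combination (-2) * hsq
  have hmem : ∀ x ∈ extremePoints ℝ S, ∀ a : ℝ, (a = c ∨ a = -c) →
      a • u + (x - (inner ℝ u x : ℝ) • u) ∈ S ∧ a • u - (x - (inner ℝ u x : ℝ) • u) ∈ S := by
    intro x hx a ha
    have hperp : inner ℝ u (x - (inner ℝ u x : ℝ) • u) = (0 : ℝ) := by
      rw [inner_sub_right, real_inner_smul_right, huu, mul_one, sub_self]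
    have hsq : a ^ 2 = c ^ 2 := by rcases ha with h | h <;> rw [h]; ring
    constructor <;> refine extremePoints_subset ((hX _).2 ⟨?_, ?_⟩)
    · rw [← sq_eq_sq₀ (norm_nonneg _) zero_le_one, norm_add_sq_real, hV x hx,
        real_inner_smul_left, hperp, norm_smul, hu, Real.norm_eq_abs, mul_one, sq_abs, hsq]
      ring
    · rw [inner_add_right, hperp, real_inner_smul_right, huu]
      simpa using ha
    · rw [← sq_eq_sq₀ (norm_nonneg _) zero_le_one, norm_sub_sq_real, hV x hx,
        real_inner_smul_left, hperp, norm_smul, hu, Real.norm_eq_abs, mul_one, sq_abs, hsq]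
      ring
    · rw [inner_sub_right, hperp, real_inner_smul_right, huu]
      simpa using ha
  have hmid : ∀ a : ℝ, (a = c ∨ a = -c) → a • u ∈ S := fun a ha => by
    obtain ⟨x, hx⟩ := hne
    obtain ⟨h1, h2⟩ := hmem x hx a ha
    have := hS h1 h2 (by norm_num : (0 : ℝ) ≤ 1 / 2) (by norm_num : (0 : ℝ) ≤ 1 / 2) (by norm_num)
    convert this using 1
    module
  have hpt : (c / 2) • u ∈ S := by
    have := hS (hmid c (Or.inl rfl)) (hmid (-c) (Or.inr rfl)) (by norm_num : (0 : ℝ) ≤ 3 / 4)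
      (by norm_num : (0 : ℝ) ≤ 1 / 4) (by norm_num)
    convert this using 1
    module
  obtain ⟨k, s, l, hk, hs, ⟨e, he0, he1, hes⟩, hl0, hl1, hlx⟩ := hD _ hpt
  let V : Fin k → E := fun j => s j - (inner ℝ u (s j) : ℝ) • u
  have hi : ∀ j, inner ℝ u (s j) = c ∨ inner ℝ u (s j) = -c := fun j => ((hX _).1 (hs j)).2
  have hlin : ∀ j x, e j x = (e j).linear x + e j 0 := fun j x => by
    simpa using congrFun (e j).decomp x
  -- values of an effect on a horizontal disc
  have hsum : ∀ j i (a : ℝ), e i (a • u + V j) + e i (a • u - V j) = 2 * e i (a • u) := by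
    intro j i a
    generalize V j = w
    rw [hlin i (a • u + w), hlin i (a • u - w), hlin i (a • u), map_add, map_sub]
    ring
  have hsV : ∀ j, s j = (inner ℝ u (s j) : ℝ) • u + V j := fun j => by simp [V]
  have hhalf : ∀ j, 1 / 2 ≤ e j ((inner ℝ u (s j) : ℝ) • u) := fun j => by
    have h1 := hsum j j (inner ℝ u (s j))
    rw [← hsV j, hes j] at h1
    linarith [he0 j _ (hmem _ (hs j) _ (hi j)).2]
  -- an effect vanishing at the centre of a disc has no horizontal part
  have hflat : ∀ j a, (a = c ∨ a = -c) → e j (a • u) = 0 →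
      e j ((inner ℝ u (s j) : ℝ) • u) = 1 := fun j a ha h0 => by
    have h1 := hsum j j a
    have h2 := he0 j _ (hmem _ (hs j) a ha).1
    have h3 := he0 j _ (hmem _ (hs j) a ha).2
    change 0 ≤ e j (a • u + V j) at h2
    change 0 ≤ e j (a • u - V j) at h3
    have h4 : e j (a • u + V j) = 0 := by linarith
    have h5 := hes j
    rw [hsV j, hlin j, map_add] at h5
    rw [hlin j, map_add] at h4
    rw [hlin j] at h0 ⊢
    linarith
  have hpair : ∀ i j, i ≠ j → ∀ x ∈ S, e i x + e j x ≤ 1 := fun i j hij x hx => by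
    rw [← he1 x hx, ← Finset.sum_pair (f := fun m => e m x) hij]
    exact Finset.sum_le_univ_sum_of_nonneg fun m => he0 m x hx
  classical
  let top : Finset (Fin k) := Finset.univ.filter fun j => inner ℝ u (s j) = c
  have htop : ∀ j, j ∈ top ↔ inner ℝ u (s j) = c := fun j => by simp [top]
  have hbot : ∀ j, j ∉ top → inner ℝ u (s j) = -c := fun j hj =>
    (hi j).resolve_left fun h => hj ((htop j).2 h)
  have hsplit : ∑ j ∈ top, l j + ∑ j ∈ topᶜ, l j = 1 := by rw [Finset.sum_add_sum_compl, hl1]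
  have hheight : ∑ j ∈ top, l j - ∑ j ∈ topᶜ, l j = 1 / 2 := by
    have h1 := congrArg (fun x => (inner ℝ u x : ℝ)) hlx
    simp only [inner_sum, real_inner_smul_right, huu] at h1
    rw [← Finset.sum_add_sum_compl top, Finset.sum_congr rfl fun j hj => by rw [(htop j).1 hj],
      Finset.sum_congr (s₁ := topᶜ) rfl fun j hj => by rw [hbot j (Finset.mem_compl.1 hj)],
      ← Finset.sum_mul, ← Finset.sum_mul] at h1
    have : c * (∑ j ∈ top, l j - ∑ j ∈ topᶜ, l j) = c * (1 / 2) := by linarith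
    exact mul_left_cancel₀ hc.ne' this
  have hhor : ∑ j ∈ top, l j • V j + ∑ j ∈ topᶜ, l j • V j = 0 := by
    rw [Finset.sum_add_sum_compl]
    simp only [V, smul_sub, Finset.sum_sub_distrib, hlx, smul_smul, ← Finset.sum_smul]
    rw [← sub_smul]
    have h1 := congrArg (fun x => (inner ℝ u x : ℝ)) hlx
    simp only [inner_sum, real_inner_smul_right, huu] at h1
    rw [h1]
    simp
  have hVn : ∀ j, ‖V j‖ = √(1 - c ^ 2) := fun j => by
    rw [← hV (s j) (hs j), Real.sqrt_sq (norm_nonneg _)]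
  have hr : 0 < √(1 - c ^ 2) := Real.sqrt_pos.2 (by nlinarith)
  rcases Nat.lt_or_ge 1 top.card with hcard | hcard
  · obtain ⟨i, hit, i', hit', hne'⟩ := Finset.one_lt_card.1 hcard
    obtain ⟨j, hj⟩ : ∃ j, j ∉ top := by
      by_contra hcon
      push Not at hcon
      have : topᶜ = ∅ := by
        ext j
        simp [hcon j]
      rw [this, Finset.sum_empty] at hsplit hheight
      linarith
    have hij : i ≠ j := fun h => hj (h ▸ hit)
    have hij' : i' ≠ j := fun h => hj (h ▸ hit')
    have h3 : e i (c • u) + (e i' (c • u) + e j (c • u)) ≤ 1 := by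
      rw [← he1 _ (hmid c (Or.inl rfl)), ← Finset.sum_pair (f := fun m => e m (c • u)) hij',
        ← Finset.sum_insert (f := fun m => e m (c • u)) (by simp [*])]
      exact Finset.sum_le_univ_sum_of_nonneg fun m => he0 m _ (hmid c (Or.inl rfl))
    have hhi := hhalf i
    have hhi' := hhalf i'
    rw [(htop i).1 hit] at hhi
    rw [(htop i').1 hit'] at hhi'
    have hj0 := he0 j _ (hmid c (Or.inl rfl))
    have hj1 := hflat j c (Or.inl rfl) (by linarith)
    rw [hbot j hj] at hj1
    have h4 := hpair i j hij _ (hmid (-c) (Or.inr rfl))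
    have h5 := he0 i _ (hmid (-c) (Or.inr rfl))
    have h6 := hflat i (-c) (Or.inr rfl) (by linarith)
    rw [(htop i).1 hit] at h6
    linarith
  · have hbound : ‖∑ j ∈ topᶜ, l j • V j‖ ≤ (∑ j ∈ topᶜ, l j) * √(1 - c ^ 2) := by
      rw [Finset.sum_mul]
      refine (norm_sum_le _ _).trans (Finset.sum_le_sum fun j _ => ?_)
      rw [norm_smul, hVn, Real.norm_of_nonneg (hl0 j)]
    have htopn : ‖∑ j ∈ top, l j • V j‖ = (∑ j ∈ top, l j) * √(1 - c ^ 2) := by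
      have : Nonempty (Fin k) := ⟨⟨0, hk⟩⟩
      rcases Finset.card_le_one_iff_subset_singleton.1 hcard |>.imp fun i hi =>
        Finset.subset_singleton_iff.1 hi with ⟨i, h | h⟩
      · simp [h]
      · rw [h, Finset.sum_singleton, Finset.sum_singleton, norm_smul, hVn,
          Real.norm_of_nonneg (hl0 i)]
    rw [eq_neg_of_add_eq_zero_left hhor, norm_neg] at htopn
    rw [htopn] at hbound
    have := le_of_mul_le_mul_right hbound hr
    linarith

end Cylinder

section FinitelyManyExtremePoints

open Module MeasureTheory

variable {E : Type*} [NormedAddCommGroup E] [NormedSpace ℝ E]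

lemma Distinguishable.apply_ne {S : Set E} {k : ℕ} {s : Fin k → E} (hs : ∀ j : Fin k, s j ∈ S)
    {e : Fin k → E →ᵃ[ℝ] ℝ} (he0 : ∀ i, ∀ x ∈ S, 0 ≤ e i x) (he1 : ∀ x ∈ S, ∑ i, e i x = 1)
    (hes : ∀ i, e i (s i) = 1) {i j : Fin k} (hij : i ≠ j) : e i (s j) = 0 := by
  have h := he1 _ (hs j)
  rw [← Finset.add_sum_erase _ _ (Finset.mem_univ j), hes j, add_eq_left] at h
  exact (Finset.sum_eq_zero_iff_of_nonneg fun m _ => he0 m _ (hs j)).1 h i (by simp [hij])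

/-- If a distinguishable family affinely spans the space, `S` is its convex hull, a simplex. -/
lemma Distinguishable.eq_convexHull {S : Set E} (hS : Convex ℝ S) {k : ℕ} {s : Fin k → E}
    (hd : Distinguishable S s) (hs : ∀ j, s j ∈ S) (hspan : affineSpan ℝ (range s) = ⊤) :
    AffineIndependent ℝ s ∧ S = convexHull ℝ (range s) := by
  obtain ⟨e, he0, he1, hes⟩ := hd
  have happly : ∀ (l : Fin k → ℝ), ∑ j, l j = 1 → ∀ i, e i (∑ j, l j • s j) = l i := by
    intro l hl i
    rw [AffineMap.map_sum_smul _ _ _ hl, Finset.sum_eq_single i]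
    · rw [hes, smul_eq_mul, mul_one]
    · intro j _ hj
      rw [Distinguishable.apply_ne hs he0 he1 hes hj.symm, smul_zero]
    · simp
  refine ⟨?_, Subset.antisymm (fun x hx => ?_)
    (convexHull_min (range_subset_iff.2 hs) hS)⟩
  · rw [affineIndependent_iff_eq_of_fintype_affineCombination_eq]
    intro w₁ w₂ h₁ h₂ h
    rw [Finset.affineCombination_eq_linear_combination _ _ _ h₁,
      Finset.affineCombination_eq_linear_combination _ _ _ h₂] at h
    ext i
    rw [← happly w₁ h₁ i, ← happly w₂ h₂ i, h]
  · have hx' : x ∈ affineSpan ℝ (range s) := hspan ▸ AffineSubspace.mem_top ℝ E x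
    obtain ⟨w, hw, rfl⟩ := eq_affineCombination_of_mem_affineSpan_of_fintype hx'
    rw [Finset.affineCombination_eq_linear_combination _ _ _ hw] at hx ⊢
    refine (convex_convexHull ℝ _).sum_mem (fun i _ => ?_) hw
      fun i _ => subset_convexHull ℝ _ (mem_range_self i)
    rw [← happly w hw i]
    exact he0 i _ hx

/-- A distinguishably decomposable body with finitely many extreme points is a simplex. -/
lemma DistinguishablyDecomposable.exists_simplex [FiniteDimensional ℝ E] {S : Set E}
    (hS : Convex ℝ S) (hspan : affineSpan ℝ S = ⊤) (hfin : (extremePoints ℝ S).Finite)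
    (hD : DistinguishablyDecomposable S) :
    ∃ s : Fin (finrank ℝ E + 1) → E, AffineIndependent ℝ s ∧ S = convexHull ℝ (range s) := by
  borelize E
  obtain ⟨k, s, hs, hd, htop⟩ : ∃ (k : ℕ) (s : Fin k → E), (∀ j, s j ∈ extremePoints ℝ S) ∧
      Distinguishable S s ∧ affineSpan ℝ (range s) = ⊤ := by
    by_contra! hcon
    let F : Set (Set E) := {Y | Y ⊆ extremePoints ℝ S ∧ affineSpan ℝ Y ≠ ⊤}
    have hF : F.Finite := hfin.finite_subsets.subset fun Y hY => hY.1
    have hsub : S ⊆ ⋃ Y ∈ F, (affineSpan ℝ Y : Set E) := by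
      intro x hx
      obtain ⟨k, s, l, hk, hs, hd, hl0, hl1, rfl⟩ := hD x hx
      refine mem_biUnion (x := range s) ⟨range_subset_iff.2 hs, hcon k s hs hd⟩ ?_
      rw [← Finset.affineCombination_eq_linear_combination _ _ _ hl1]
      exact affineCombination_mem_affineSpan hl1 s
    have hzero : (Measure.addHaar : Measure E) S = 0 := by
      refine measure_mono_null hsub ((measure_biUnion_null_iff hF.countable).2 fun Y hY => ?_)
      exact Measure.addHaar_affineSubspace _ _ hY.2
    have hint := hS.interior_nonempty_iff_affineSpan_eq_top.2 hspan
    exact (isOpen_interior.measure_pos _ hint).ne'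
      (measure_mono_null interior_subset hzero)
  obtain ⟨hind, hhull⟩ := hd.eq_convexHull hS (fun j => extremePoints_subset (hs j)) htop
  have hk := (hind.affineSpan_eq_top_iff_card_eq_finrank_add_one).1 htop
  rw [Fintype.card_fin] at hk
  subst hk
  exact ⟨s, hind, hhull⟩

end FinitelyManyExtremePoints

section Normalization

open Module MeasureTheory

lemma AffineEquiv.apply_eq_linear_add {E : Type*} [AddCommGroup E] [Module ℝ E] (f : E ≃ᵃ[ℝ] E)
    (x : E) : f x = f.linear x + f 0 := by
  simpa using congrFun (f : E →ᵃ[ℝ] E).decomp x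

/-- An affine automorphism of a body preserves the volume on the body. -/
lemma AffineEquiv.measurePreserving_restrict {E : Type*} [NormedAddCommGroup E] [NormedSpace ℝ E]
    [FiniteDimensional ℝ E] [MeasurableSpace E] [BorelSpace E] (μ : Measure E)
    [μ.IsAddHaarMeasure] {S : Set E} (h0 : μ S ≠ 0) (htop : μ S ≠ ⊤) (f : E ≃ᵃ[ℝ] E)
    (hf : f '' S = S) : MeasurePreserving f (μ.restrict S) (μ.restrict S) := by
  have hcont : Continuous f := (f : E →ᵃ[ℝ] E).continuous_of_finiteDimensional
  have hemb : MeasurableEmbedding f :=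
    f.toContinuousAffineEquiv.toHomeomorph.isClosedEmbedding.measurableEmbedding
  have hlin : Continuous (f.linear : E →ₗ[ℝ] E) := LinearMap.continuous_of_finiteDimensional _
  obtain ⟨κ, hκ⟩ : ∃ κ : ENNReal, μ.map f = κ • μ := by
    have hdet : LinearMap.det (f.linear : E →ₗ[ℝ] E) ≠ 0 := f.linear.isUnit_det'.ne_zero
    refine ⟨ENNReal.ofReal |(LinearMap.det (f.linear : E →ₗ[ℝ] E))⁻¹|, ?_⟩
    have : (f : E → E) = (fun x => x + f 0) ∘ (f.linear : E →ₗ[ℝ] E) := by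
      ext x
      exact f.apply_eq_linear_add x
    rw [this, ← Measure.map_map (measurable_add_const _) hlin.measurable,
      Measure.map_linearMap_addHaar_eq_smul_addHaar μ hdet, Measure.map_smul,
      map_add_right_eq_self]
  have hpre : f ⁻¹' S = S := by
    conv_lhs => rw [← hf]
    exact f.injective.preimage_image S
  have hmap : (μ.restrict S).map f = κ • μ.restrict S := by
    rw [← Measure.restrict_smul, ← hκ, hemb.restrict_map, hpre]
  have hmass := congrArg (fun ν : Measure E => ν univ) hmap
  simp only [hemb.map_apply, preimage_univ, Measure.smul_apply, Measure.restrict_apply_univ,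
    smul_eq_mul] at hmass
  have hκ1 : κ = 1 := by
    rw [eq_comm, ENNReal.mul_eq_right h0 htop] at hmass
    exact hmass
  exact ⟨hcont.measurable, by rw [hmap, hκ1, one_smul]⟩

variable {E : Type*} [NormedAddCommGroup E] [InnerProductSpace ℝ E]

/-- Every affine automorphism of `S` is a linear isometry. -/
def IsometricAutomorphisms (S : Set E) : Prop :=
  ∀ f : E ≃ᵃ[ℝ] E, f '' S = S → ∃ g : E ≃ₗᵢ[ℝ] E, ∀ x, f x = g x

lemma not_forall_extremePoints_inner_eq {S : Set E} (hSc : IsCompact S) (hS : Convex ℝ S)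
    (hspan : affineSpan ℝ S = ⊤) {u : E} (hu : ‖u‖ = 1) (a : ℝ) :
    ¬ ∀ x ∈ extremePoints ℝ S, inner ℝ u x = a := by
  intro h
  have hsub : S ⊆ {x | inner ℝ u x = a} := by
    rw [← closure_convexHull_extremePoints hSc hS]
    refine closure_minimal (convexHull_min h ?_) (isClosed_eq (by fun_prop) (by fun_prop))
    exact convex_hyperplane (innerₛₗ ℝ u).isLinear a
  have hall : ∀ x : E, inner ℝ u x = a := fun x => by
    have hx : x ∈ affineSpan ℝ S := hspan ▸ AffineSubspace.mem_top ℝ E x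
    refine affineSpan_induction (p := fun x => inner ℝ u x = a) hx hsub fun r x y z hx hy hz => ?_
    rw [vsub_eq_sub, vadd_eq_add, inner_add_right, real_inner_smul_right, inner_sub_right, hx, hy,
      hz]
    ring
  have h0 := hall 0
  have h1 := hall u
  rw [inner_zero_right] at h0
  rw [← h0, real_inner_self_eq_norm_sq, hu] at h1
  norm_num at h1

variable [FiniteDimensional ℝ E]

/-- A convex body can be moved by an affine transformation to a position in which all its affine
automorphisms are linear isometries. -/
lemma exists_affineEquiv_isometric_automorphisms {S : Set E} (hSc : IsCompact S)
    (hS : Convex ℝ S) (hspan : affineSpan ℝ S = ⊤) :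
    ∃ T : E ≃ᵃ[ℝ] E, IsometricAutomorphisms (T '' S) := by
  borelize E
  let μ : Measure E := Measure.addHaar
  have h0 : μ S ≠ 0 := fun h => (isOpen_interior.measure_pos μ
    (hS.interior_nonempty_iff_affineSpan_eq_top.2 hspan)).ne' (measure_mono_null interior_subset h)
  have htop : μ S ≠ ⊤ := hSc.measure_ne_top
  have hfin : IsFiniteMeasure (μ.restrict S) := ⟨by simpa using htop.lt_top⟩
  let m : ℝ := μ.real S
  have hm : m ≠ 0 := (ENNReal.toReal_pos h0 htop).ne'
  let c : E := m⁻¹ • ∫ x in S, x ∂μ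
  have hint : Integrable (fun x : E => x) (μ.restrict S) :=
    continuousOn_id.integrableOn_compact hSc
  have hfix : ∀ f : E ≃ᵃ[ℝ] E, f '' S = S → f c = c := by
    intro f hf
    let L : E →L[ℝ] E := LinearMap.toContinuousLinearMap (f.linear : E →ₗ[ℝ] E)
    have hL : ∀ x, f x = L x + f 0 := f.apply_eq_linear_add
    have hmp := f.measurePreserving_restrict μ h0 htop hf
    have h1 : ∫ x in S, f x ∂μ = ∫ x in S, x ∂μ :=
      hmp.integral_comp f.toContinuousAffineEquiv.toHomeomorph.isClosedEmbedding.measurableEmbedding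
        (fun x => x)
    rw [show (fun x => f x) = fun x => L x + f 0 from funext hL] at h1
    rw [integral_add (L.integrable_comp hint) (integrable_const _),
      L.integral_comp_comm hint, integral_const, measureReal_restrict_apply_univ] at h1
    rw [hL]
    change L (m⁻¹ • ∫ x in S, x ∂μ) + f 0 = m⁻¹ • ∫ x in S, x ∂μ
    rw [map_smul]
    nth_rewrite 2 [← h1]
    rw [smul_add, smul_smul, inv_mul_cancel₀ hm, one_smul]
  have hmem : ∀ y : E, MemLp (fun x => (inner ℝ y (x - c) : ℝ)) 2 (μ.restrict S) := by
    intro y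
    have hcont : Continuous fun x => (inner ℝ y (x - c) : ℝ) := by fun_prop
    obtain ⟨C, hC⟩ := hSc.exists_bound_of_continuousOn hcont.continuousOn
    exact MemLp.of_bound hcont.aestronglyMeasurable C
      ((ae_restrict_iff' hSc.measurableSet).2 (.of_forall hC))
  let Φ : E →ₗ[ℝ] Lp ℝ 2 (μ.restrict S) :=
    { toFun := fun y => (hmem y).toLp _
      map_add' := fun y z => by
        rw [← MemLp.toLp_add]
        congr 1
        ext x
        simp [inner_add_left]
      map_smul' := fun r y => by
        rw [RingHom.id_apply, ← MemLp.toLp_const_smul]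
        congr 1
        ext x
        simp [real_inner_smul_left] }
  have hΦinj : Function.Injective Φ := by
    refine (injective_iff_map_eq_zero Φ).2 fun y hy => ?_
    by_contra hy0
    have hae : (fun x => (inner ℝ y (x - c) : ℝ)) =ᵐ[μ.restrict S] 0 :=
      (hmem y).coeFn_toLp.symm.trans (Lp.eq_zero_iff_ae_eq_zero.1 hy)
    let H : AffineSubspace ℝ E := AffineSubspace.mk' c (Submodule.span ℝ {y})ᗮ
    have hH : H ≠ ⊤ := fun h => by
      have h1 : y ∈ H.direction := by rw [h, AffineSubspace.direction_top]; trivial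
      rw [AffineSubspace.direction_mk', Submodule.mem_orthogonal_singleton_iff_inner_right] at h1
      exact hy0 (inner_self_eq_zero.1 h1)
    have hnot : ∀ᵐ x ∂μ.restrict S, x ∉ H := ae_restrict_of_ae
      (measure_eq_zero_iff_ae_notMem.1 (Measure.addHaar_affineSubspace μ H hH))
    have hfalse : ∀ᵐ x ∂μ.restrict S, False := by
      filter_upwards [hae, hnot] with x hx hx'
      exact hx' ((AffineSubspace.mem_mk').2
        (Submodule.mem_orthogonal_singleton_iff_inner_right.2 hx))
    rw [Filter.eventually_false_iff_eq_bot, ae_eq_bot, Measure.restrict_eq_zero] at hfalse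
    exact h0 hfalse
  let B : E ≃ₗ[ℝ] E := (LinearEquiv.ofInjective Φ hΦinj).trans
    ((stdOrthonormalBasis ℝ (LinearMap.range Φ)).equiv (stdOrthonormalBasis ℝ E)
      (finCongr (LinearMap.finrank_range_of_inj hΦinj))).toLinearEquiv
  have hB : ∀ y, ‖B y‖ = ‖Φ y‖ := fun y => by
    simp only [B, LinearEquiv.trans_apply, LinearIsometryEquiv.coe_toLinearEquiv,
      LinearIsometryEquiv.norm_map]
    rfl
  have hA : ∀ x y, inner ℝ (LinearMap.adjoint (B.symm : E →ₗ[ℝ] E) x) (B y) = inner ℝ x y :=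
    fun x y => by simp [LinearMap.adjoint_inner_left]
  let A : E ≃ₗ[ℝ] E := LinearEquiv.ofInjectiveEndo (LinearMap.adjoint (B.symm : E →ₗ[ℝ] E))
    ((injective_iff_map_eq_zero _).2 fun x hx => inner_self_eq_zero.1 (by
      rw [← hA x x, hx, inner_zero_left]))
  replace hA : ∀ x y, inner ℝ (A x) (B y) = inner ℝ x y := hA
  let T : E ≃ᵃ[ℝ] E := (AffineEquiv.vaddConst ℝ c).symm.trans A.toAffineEquiv
  have hT : ∀ x, T x = A (x - c) := fun x => rfl
  refine ⟨T, fun f' hf' => ?_⟩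
  let f : E ≃ᵃ[ℝ] E := (T.trans f').trans T.symm
  have hfT : ∀ x, f' (T x) = T (f x) := fun x => by simp [f]
  have hf : f '' S = S := by
    apply T.injective.image_injective
    rw [image_image]
    simp only [← hfT]
    rwa [← image_image]
  have hmp := f.measurePreserving_restrict μ h0 htop hf
  have hfc : ∀ x, f x - c = f.linear (x - c) := fun x => by
    conv_lhs => rw [← hfix f hf]
    exact (f : E →ᵃ[ℝ] E).linearMap_vsub x c |>.symm
  let L : E →ₗ[ℝ] E := f.linear
  have hnorm : ∀ y, ‖B (LinearMap.adjoint L y)‖ = ‖B y‖ := by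
    intro y
    rw [hB, hB]
    change ‖(hmem _).toLp _‖ = ‖(hmem _).toLp _‖
    rw [Lp.norm_toLp, Lp.norm_toLp,
      ← eLpNorm_comp_measurePreserving (hmem y).aestronglyMeasurable hmp]
    congr 2
    ext x
    rw [Function.comp_apply, hfc, LinearMap.adjoint_inner_left]
    rfl
  let G : E →ₗᵢ[ℝ] E :=
    { toLinearMap := (B : E →ₗ[ℝ] E) ∘ₗ LinearMap.adjoint L ∘ₗ (B.symm : E →ₗ[ℝ] E)
      norm_map' := fun y => by simpa using hnorm (B.symm y) }
  have hG : ∀ y, G (B y) = B (LinearMap.adjoint L y) := fun y => by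
    change B (LinearMap.adjoint L (B.symm (B y))) = _
    rw [B.symm_apply_apply]
  let g := G.toLinearIsometryEquiv rfl
  refine ⟨g.symm, fun x => ?_⟩
  obtain ⟨z, rfl⟩ := T.surjective x
  refine ext_inner_right ℝ fun y => ?_
  obtain ⟨y, rfl⟩ := B.surjective y
  have h1 : inner ℝ (g.symm (T z)) (B y) = inner ℝ (T z) (G (B y)) := by
    rw [← g.inner_map_map, g.apply_symm_apply]
    rfl
  rw [h1, hG, hfT, hT, hT, hA, hA, hfc, LinearMap.adjoint_inner_right]
  rfl

/-- A convex body whose automorphisms act transitively on its extreme points can be moved by an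
affine transformation to a position in which the automorphisms are linear isometries and the
extreme points are unit vectors. -/
lemma AutTransitiveOnExtreme.exists_normalization [Nontrivial E] {S : Set E} (hSc : IsCompact S)
    (hS : Convex ℝ S) (hspan : affineSpan ℝ S = ⊤) (hA : AutTransitiveOnExtreme S) :
    ∃ T : E ≃ᵃ[ℝ] E, IsometricAutomorphisms (T '' S) ∧
      ∀ x ∈ extremePoints ℝ (T '' S), ‖x‖ = 1 := by
  obtain ⟨T, hT⟩ := exists_affineEquiv_isometric_automorphisms hSc hS hspan
  have hTc : IsCompact (T '' S) :=
    hSc.image (T : E →ᵃ[ℝ] E).continuous_of_finiteDimensional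
  have hTS : Convex ℝ (T '' S) := hS.affine_image (T : E →ᵃ[ℝ] E)
  have hTspan := (AffineEquiv.span_eq_top_iff T).1 hspan
  have hTA := hA.image T
  obtain ⟨ρ, hρ⟩ : ∃ ρ : ℝ, ∀ x ∈ extremePoints ℝ (T '' S), ‖x‖ = ρ := by
    rcases (extremePoints ℝ (T '' S)).eq_empty_or_nonempty with h | ⟨x, hx⟩
    · exact ⟨0, by simp [h]⟩
    · refine ⟨‖x‖, fun y hy => ?_⟩
      obtain ⟨f, hf, rfl⟩ := hTA x hx y hy
      obtain ⟨g, hg⟩ := hT f hf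
      rw [hg, g.norm_map]
  have hρ0 : ρ ≠ 0 := by
    rintro rfl
    obtain ⟨u, hu⟩ := exists_norm_eq E zero_le_one
    refine not_forall_extremePoints_inner_eq hTc hTS hTspan hu 0 fun x hx => ?_
    rw [norm_eq_zero.1 (hρ x hx), inner_zero_right]
  let h : E ≃ₗ[ℝ] E := LinearEquiv.smulOfNeZero ℝ E ρ⁻¹ (inv_ne_zero hρ0)
  have hh : ∀ x, h x = ρ⁻¹ • x := fun x => rfl
  have himage : (T.trans h.toAffineEquiv) '' S = h.toAffineEquiv '' (T '' S) := by
    rw [image_image]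
    rfl
  refine ⟨T.trans h.toAffineEquiv, ?_, ?_⟩ <;> rw [himage]
  · intro f hf
    obtain ⟨g, hg⟩ := hT ((h.toAffineEquiv.trans f).trans h.toAffineEquiv.symm) (by
      apply h.toAffineEquiv.injective.image_injective
      rw [image_image]
      simp only [AffineEquiv.trans_apply, AffineEquiv.apply_symm_apply]
      rw [← image_image f, hf])
    refine ⟨g, fun x => ?_⟩
    have h1 := hg (ρ • x)
    rw [AffineEquiv.trans_apply, AffineEquiv.trans_apply] at h1
    have h2 : h.toAffineEquiv (ρ • x) = x := by
      change ρ⁻¹ • ρ • x = x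
      rw [smul_smul, inv_mul_cancel₀ hρ0, one_smul]
    rw [h2, map_smul] at h1
    have h3 := congrArg h.toAffineEquiv h1
    rw [AffineEquiv.apply_symm_apply] at h3
    rw [h3]
    change ρ⁻¹ • ρ • g x = g x
    rw [smul_smul, inv_mul_cancel₀ hρ0, one_smul]
  · rw [← AffineEquiv.image_extremePoints]
    rintro _ ⟨x, hx, rfl⟩
    change ‖ρ⁻¹ • x‖ = 1
    have hρx := hρ x hx
    rw [norm_smul, norm_inv, hρx, Real.norm_of_nonneg (hρx ▸ norm_nonneg x), inv_mul_cancel₀ hρ0]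

end Normalization

section Ball

open Module

variable {E : Type*} [NormedAddCommGroup E] [InnerProductSpace ℝ E]

lemma subset_closedBall_of_extremePoints {S : Set E} (hSc : IsCompact S) (hS : Convex ℝ S)
    (h1 : ∀ x ∈ extremePoints ℝ S, ‖x‖ = 1) : S ⊆ closedBall 0 1 := by
  rw [← closure_convexHull_extremePoints hSc hS]
  refine closure_minimal (convexHull_min (fun x hx => ?_) (convex_closedBall 0 1))
    isClosed_closedBall
  rw [mem_closedBall_zero_iff, h1 x hx]

lemma extremePoints_eq_inter_sphere {S : Set E} (hSc : IsCompact S) (hS : Convex ℝ S)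
    (h1 : ∀ x ∈ extremePoints ℝ S, ‖x‖ = 1) : extremePoints ℝ S = S ∩ sphere 0 1 := by
  refine Subset.antisymm
    (fun x hx => ⟨extremePoints_subset hx, mem_sphere_zero_iff_norm.2 (h1 x hx)⟩) ?_
  exact fun x hx => inter_extremePoints_subset_extremePoints_of_subset
    (subset_closedBall_of_extremePoints hSc hS h1)
    ⟨hx.1, StrictConvexSpace.sphere_subset_extremePoints_closedBall 0 one_ne_zero hx.2⟩

variable [FiniteDimensional ℝ E]

/-- Infinitely many isometries of a finite-dimensional space contain arbitrarily close pairs. -/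
lemma exists_ne_norm_sub_le {ι : Type*} [Infinite ι] (g : ι → E ≃ₗᵢ[ℝ] E) {ε : ℝ} (hε : 0 < ε) :
    ∃ i j, i ≠ j ∧ ∀ x, ‖g i x - g j x‖ ≤ ε * ‖x‖ := by
  let F : ι → E →L[ℝ] E := fun i => (g i).toLinearIsometry.toContinuousLinearMap
  have hF : ∀ i, F i ∈ closedBall (0 : E →L[ℝ] E) 1 := fun i => by
    rw [mem_closedBall_zero_iff]
    exact (g i).toLinearIsometry.norm_toContinuousLinearMap_le
  have : ProperSpace (E →L[ℝ] E) := FiniteDimensional.proper ℝ _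
  obtain ⟨t, ht, hcover⟩ := Metric.totallyBounded_iff.1
    (isCompact_closedBall (0 : E →L[ℝ] E) 1).totallyBounded (ε / 2) (half_pos hε)
  have hex : ∀ i, ∃ y : t, F i ∈ ball (y : E →L[ℝ] E) (ε / 2) := fun i => by
    simpa using hcover (hF i)
  choose c hc using hex
  have : Finite t := ht
  obtain ⟨i, j, hij, hcij⟩ := Finite.exists_ne_map_eq_of_infinite c
  refine ⟨i, j, hij, fun x => ?_⟩
  have hd : ‖F i - F j‖ ≤ ε := by
    rw [← dist_eq_norm]
    have h1 := hc i
    have h2 := hc j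
    rw [hcij] at h1
    rw [mem_ball] at h1 h2
    linarith [dist_triangle_right (F i) (F j) (c j)]
  exact ((F i - F j).le_opNorm x).trans (by gcongr)

/-- A normalized body with infinitely many extreme points is a ball. -/
lemma DistinguishablyDecomposable.eq_closedBall (hE : finrank ℝ E = 3)
    {S : Set E} (hSc : IsCompact S) (hS : Convex ℝ S)
    (hspan : affineSpan ℝ S = ⊤) (hA : AutTransitiveOnExtreme S)
    (hD : DistinguishablyDecomposable S) (hI : IsometricAutomorphisms S)
    (h1 : ∀ x ∈ extremePoints ℝ S, ‖x‖ = 1) (hinf : (extremePoints ℝ S).Infinite) :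
    S = closedBall 0 1 := by
  have hXeq := extremePoints_eq_inter_sphere hSc hS h1
  have hXc : IsCompact (extremePoints ℝ S) := by
    rw [hXeq]
    exact hSc.inter_right isClosed_sphere
  obtain ⟨x₀, hx₀⟩ := hinf.nonempty
  have hmove : ∀ y : extremePoints ℝ S, ∃ g : E ≃ₗᵢ[ℝ] E,
      g '' extremePoints ℝ S = extremePoints ℝ S ∧ g x₀ = y := by
    rintro ⟨y, hy⟩
    obtain ⟨f, hf, rfl⟩ := hA x₀ hx₀ y hy
    obtain ⟨g, hg⟩ := hI f hf
    refine ⟨g, ?_, (hg x₀).symm⟩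
    rw [← show ⇑f = g from funext hg, f.image_extremePoints, hf]
  choose g hgX hg₀ using hmove
  have : Infinite (extremePoints ℝ S) := hinf.to_subtype
  obtain ⟨u, hu, hsymm⟩ : ∃ u : E, ‖u‖ = 1 ∧ AxiallySymmetric (extremePoints ℝ S) u := by
    refine exists_axis_of_small_symmetries hE hXc.isClosed fun ε hε => ?_
    obtain ⟨y, z, hyz, hclose⟩ := exists_ne_norm_sub_le g hε
    refine ⟨(g y).trans (g z).symm, ⟨x₀, fun h => hyz ?_⟩, fun x => ?_, fun x hx => ?_⟩
    · rw [LinearIsometryEquiv.trans_apply, LinearIsometryEquiv.symm_apply_eq, hg₀, hg₀] at h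
      exact Subtype.ext h
    · rw [← (g z).norm_map, map_sub, LinearIsometryEquiv.trans_apply,
        LinearIsometryEquiv.apply_symm_apply]
      exact hclose x
    · have h2 : g y x ∈ g z '' extremePoints ℝ S := by
        rw [hgX z, ← hgX y]
        exact mem_image_of_mem _ hx
      obtain ⟨w, hw, hwx⟩ := h2
      rw [LinearIsometryEquiv.trans_apply, ← hwx, LinearIsometryEquiv.symm_apply_apply]
      exact hw
  by_cases hfix : ∀ y, g y u = u ∨ g y u = -u
  · exfalso
    let c : ℝ := |inner ℝ u x₀|
    have habs : ∀ y ∈ extremePoints ℝ S, |(inner ℝ u y : ℝ)| = c := fun y hy => by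
      have h2 := (g ⟨y, hy⟩).inner_map_map u x₀
      rw [hg₀] at h2
      change |(inner ℝ u y : ℝ)| = |inner ℝ u x₀|
      rw [← h2]
      rcases hfix ⟨y, hy⟩ with h | h <;> rw [h]
      rw [inner_neg_left, abs_neg]
    have hcases : ∀ y ∈ extremePoints ℝ S, inner ℝ u y = c ∨ inner ℝ u y = -c :=
      fun y hy => eq_or_eq_neg_of_abs_eq (habs y hy)
    have hc0 : 0 < c := by
      refine lt_of_le_of_ne (abs_nonneg _) fun h => ?_
      refine not_forall_extremePoints_inner_eq hSc hS hspan hu 0 fun y hy => ?_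
      rw [← abs_eq_zero, habs y hy, ← h]
    have hc1 : c < 1 := by
      refine lt_of_le_of_ne ?_ fun h => hinf (((finite_singleton (-u)).insert u).subset ?_)
      · exact (abs_real_inner_le_norm u x₀).trans (by rw [hu, h1 x₀ hx₀, one_mul])
      · intro y hy
        rcases hcases y hy with h2 | h2 <;> rw [h] at h2
        · exact Or.inl ((inner_eq_one_iff_of_norm_eq_one hu (h1 y hy)).1 h2).symm
        · right
          have h3 : inner ℝ (-u) y = (1 : ℝ) := by rw [inner_neg_left, h2, neg_neg]
          exact ((inner_eq_one_iff_of_norm_eq_one (by rwa [norm_neg]) (h1 y hy)).1 h3).symm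
    refine not_distinguishablyDecomposable_cylinder hS hu hc0 hc1 ⟨x₀, hx₀⟩ (fun x =>
      ⟨fun hx => ⟨h1 x hx, hcases x hx⟩, fun ⟨hx, hxu⟩ => ?_⟩) hD
    have hboth : ∀ a : ℝ, (a = c ∨ a = -c) → ∃ y ∈ extremePoints ℝ S, inner ℝ u y = a := by
      intro a ha
      by_contra! hcon
      refine not_forall_extremePoints_inner_eq hSc hS hspan hu (-a) fun y hy => ?_
      rcases ha with rfl | rfl
      · exact (hcases y hy).resolve_left (hcon y hy)
      · rw [neg_neg]
        exact (hcases y hy).resolve_right (hcon y hy)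
    obtain ⟨y, hy, hyu⟩ := hboth _ hxu
    exact hsymm y hy x (hx.trans (h1 y hy).symm) hyu.symm
  · push Not at hfix
    obtain ⟨y, hne, hne'⟩ := hfix
    have hsphere := AxiallySymmetric.sphere_subset hE hXc h1 ⟨x₀, hx₀⟩ ((g y).norm_map u ▸ hu) hu
      hne hne' (hsymm.map (g y) (hgX y)) hsymm
    have : Nontrivial E := nontrivial_of_finrank_pos (R := ℝ) (by rw [hE]; norm_num)
    refine Subset.antisymm (subset_closedBall_of_extremePoints hSc hS h1) ?_
    rw [← convexHull_sphere_eq_closedBall 0 zero_le_one]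
    exact convexHull_min (hsphere.trans extremePoints_subset) hS

end Ball

/-- Theorem: a compact convex `S ⊆ ℝ³` with full affine hull is affinely isomorphic to a
tetrahedron or to the closed unit ball iff its affine automorphism group acts transitively on
extreme points and `S` is distinguishably decomposable. -/
theorem three_dimensional_strongly_symmetric (S : Set (EuclideanSpace ℝ (Fin 3)))
    (hScompact : IsCompact S) (hSconvex : Convex ℝ S)
    (hspan : affineSpan ℝ S = ⊤) :
    ((∃ s : Fin 4 → EuclideanSpace ℝ (Fin 3), AffineIndependent ℝ s ∧
        AffIso S (convexHull ℝ (Set.range s))) ∨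
     AffIso S (Metric.closedBall (0 : EuclideanSpace ℝ (Fin 3)) 1)) ↔
      (AutTransitiveOnExtreme S ∧ DistinguishablyDecomposable S) := by
  have hE : Module.finrank ℝ (EuclideanSpace ℝ (Fin 3)) = 3 := finrank_euclideanSpace_fin
  constructor
  · rintro (⟨s, hs, h⟩ | h)
    · obtain ⟨f, rfl⟩ := h.exists_affineEquiv hSconvex hspan
      let b : AffineBasis (Fin 4) ℝ (EuclideanSpace ℝ (Fin 3)) :=
        ⟨s, hs, hs.affineSpan_eq_top_iff_card_eq_finrank_add_one.2 (by rw [hE, Fintype.card_fin])⟩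
      exact ⟨b.autTransitiveOnExtreme.image f, b.distinguishablyDecomposable.image f⟩
    · obtain ⟨f, rfl⟩ := h.exists_affineEquiv hSconvex hspan
      exact ⟨autTransitiveOnExtreme_closedBall.image f,
        distinguishablyDecomposable_closedBall.image f⟩
  · rintro ⟨hA, hD⟩
    by_cases hfin : (extremePoints ℝ S).Finite
    · left
      have hsimplex := hD.exists_simplex hSconvex hspan hfin
      rw [hE] at hsimplex
      obtain ⟨s, hs, hSs⟩ := hsimplex
      exact ⟨s, hs, AffineMap.id ℝ _, injOn_id _, by simpa using hSs⟩
    · right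
      obtain ⟨T, hT, hT1⟩ := hA.exists_normalization hScompact hSconvex hspan
      have hTc : IsCompact (T '' S) :=
        hScompact.image (AffineMap.continuous_of_finiteDimensional T.toAffineMap)
      have hTS : Convex ℝ (T '' S) := hSconvex.affine_image T.toAffineMap
      have hball := (hD.image T).eq_closedBall hE hTc hTS ((AffineEquiv.span_eq_top_iff T).1 hspan)
        (hA.image T) hT hT1 (by
          rw [← AffineEquiv.image_extremePoints]
          exact Set.Infinite.image T.injective.injOn hfin)
      exact AffIso.of_image T (hball ▸ ⟨AffineMap.id ℝ _, injOn_id _, by simp⟩)
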